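/- arXiv:1304.2141 — 2 statements merged into one kernel-verified Lean document; each statement's English description precedes it below -/
import Mathlib

section
/- Let a < b, let p : [a,b] → ℝ and q : [a,b] → ℝ be nonincreasing with p(x) ≤ a and q(x) ≥ b for all x ∈ [a,b], and let ψ be the associated subhedge function. Let μ and ν be probability measures on ℝ with finite first moments such that ψ is both μ-integrable and ν-integrable. Then for every martingale coupling ρ ∈ M(μ,ν): ∫ |y − x| ρ(dx,dy) ≥ ∫ ψ dν − ∫ ψ dμ. -/
open Set MeasureTheory intervalIntegral
open scoped Classical

noncomputable section

/-- θ(x) = ∫_{x₀}^x 2/(q z − p z) dz -/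
def thetaFn (p q : ℝ → ℝ) (x₀ x : ℝ) : ℝ := ∫ z in x₀..x, 2 / (q z - p z)

/-- α(x) = ∫_{x₀}^x (2x − q z − p z)/(q z − p z) dz -/
def alphaFn (p q : ℝ → ℝ) (x₀ x : ℝ) : ℝ :=
  ∫ z in x₀..x, (2 * x - q z - p z) / (q z - p z)

/-- right-continuous inverse of p : p_R⁻¹(y) = inf {x ∈ [a,b] : p x ≤ y}, = b if empty. -/
def pRinv (a b : ℝ) (p : ℝ → ℝ) (y : ℝ) : ℝ :=
  if ({x | x ∈ Icc a b ∧ p x ≤ y}).Nonempty then sInf {x | x ∈ Icc a b ∧ p x ≤ y} else b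

/-- left-continuous inverse of q : q_L⁻¹(y) = sup {x ∈ [a,b] : q x ≥ y}, = a if empty. -/
def qLinv (a b : ℝ) (q : ℝ → ℝ) (y : ℝ) : ℝ :=
  if ({x | x ∈ Icc a b ∧ y ≤ q x}).Nonempty then sSup {x | x ∈ Icc a b ∧ y ≤ q x} else a

def deltaFn (a b x₀ : ℝ) (p q : ℝ → ℝ) (x : ℝ) : ℝ :=
  if x < a then thetaFn p q x₀ (pRinv a b p x)
  else if x ≤ b then thetaFn p q x₀ x
  else thetaFn p q x₀ (qLinv a b q x)

def psiFn (a b x₀ : ℝ) (p q : ℝ → ℝ) (x : ℝ) : ℝ :=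
  if x < a then
    alphaFn p q x₀ (pRinv a b p x)
      + (pRinv a b p x - x) * (1 - thetaFn p q x₀ (pRinv a b p x))
  else if x ≤ b then alphaFn p q x₀ x
  else
    alphaFn p q x₀ (qLinv a b q x)
      + (qLinv a b q x - x) * (-1 - thetaFn p q x₀ (qLinv a b q x))

def LagFn (a b x₀ : ℝ) (p q : ℝ → ℝ) (x y : ℝ) : ℝ :=
  |y - x| + psiFn a b x₀ p q x - psiFn a b x₀ p q y + deltaFn a b x₀ p q x * (y - x)

/-- A martingale coupling of (μ, ν): a probability measure on ℝ × ℝ with first marginal μ,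
second marginal ν, such that ∫ f(x)(y − x) ρ(dx,dy) = 0 for every bounded Borel f. -/
def IsMartingaleCoupling (μ ν : Measure ℝ) (ρ : Measure (ℝ × ℝ)) : Prop :=
  IsProbabilityMeasure ρ ∧ ρ.map Prod.fst = μ ∧ ρ.map Prod.snd = ν ∧
    ∀ f : ℝ → ℝ, Measurable f → (∃ C : ℝ, ∀ x, |f x| ≤ C) →
      ∫ w : ℝ × ℝ, f w.1 * (w.2 - w.1) ∂ρ = 0

/-- The integrand of `alphaFn`, with the upper limit replaced by a free parameter `y`. -/
def dualDensity (p q : ℝ → ℝ) (y z : ℝ) : ℝ := (2 * y - q z - p z) / (q z - p z)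

/-- The affine function `y ↦ ∫_{x₀}^v (2y − q z − p z)/(q z − p z) dz`, of slope `θ(v)`. -/
def dualAffine (p q : ℝ → ℝ) (x₀ y v : ℝ) : ℝ := ∫ z in x₀..v, dualDensity p q y z

/-- The point of `[a,b]` at which the affine function supporting `ψ` at `x` is taken. -/
def supportPoint (a b : ℝ) (p q : ℝ → ℝ) (x : ℝ) : ℝ :=
  if x < a then pRinv a b p x else if x ≤ b then x else qLinv a b q x

theorem pRinv_mem {a b : ℝ} (hab : a ≤ b) (p : ℝ → ℝ) (y : ℝ) : pRinv a b p y ∈ Icc a b := by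
  unfold pRinv
  split_ifs with h
  · obtain ⟨s, hs⟩ := h
    exact ⟨le_csInf ⟨s, hs⟩ fun t ht => ht.1.1,
      (csInf_le ⟨a, fun t ht => ht.1.1⟩ hs).trans hs.1.2⟩
  · exact ⟨hab, le_rfl⟩

theorem qLinv_mem {a b : ℝ} (hab : a ≤ b) (q : ℝ → ℝ) (y : ℝ) : qLinv a b q y ∈ Icc a b := by
  unfold qLinv
  split_ifs with h
  · obtain ⟨s, hs⟩ := h
    exact ⟨hs.1.1.trans (le_csSup ⟨b, fun t ht => ht.1.2⟩ hs),
      csSup_le ⟨s, hs⟩ fun t ht => ht.1.2⟩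
  · exact ⟨le_rfl, hab⟩

theorem lt_of_lt_pRinv {a b : ℝ} {p : ℝ → ℝ} {y z : ℝ} (hz : z ∈ Icc a b)
    (h : z < pRinv a b p y) : y < p z := by
  by_contra! hc
  have hmem : z ∈ {x | x ∈ Icc a b ∧ p x ≤ y} := ⟨hz, hc⟩
  rw [pRinv, if_pos ⟨z, hmem⟩] at h
  exact h.not_ge (csInf_le ⟨a, fun t ht => ht.1.1⟩ hmem)

theorem le_of_pRinv_lt {a b : ℝ} {p : ℝ → ℝ} (hp : AntitoneOn p (Icc a b)) {y z : ℝ}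
    (hz : z ∈ Icc a b) (h : pRinv a b p y < z) : p z ≤ y := by
  unfold pRinv at h
  split_ifs at h with hne
  · obtain ⟨s, hs, hsz⟩ := exists_lt_of_csInf_lt hne h
    exact (hp hs.1 hz hsz.le).trans hs.2
  · exact absurd hz.2 h.not_ge

theorem le_of_lt_qLinv {a b : ℝ} {q : ℝ → ℝ} (hq : AntitoneOn q (Icc a b)) {y z : ℝ}
    (hz : z ∈ Icc a b) (h : z < qLinv a b q y) : y ≤ q z := by
  unfold qLinv at h
  split_ifs at h with hne
  · obtain ⟨s, hs, hsz⟩ := exists_lt_of_lt_csSup hne h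
    exact hs.2.trans (hq hz hs.1 hsz.le)
  · exact absurd hz.1 h.not_ge

theorem lt_of_qLinv_lt {a b : ℝ} {q : ℝ → ℝ} {y z : ℝ} (hz : z ∈ Icc a b)
    (h : qLinv a b q y < z) : q z < y := by
  by_contra! hc
  have hmem : z ∈ {x | x ∈ Icc a b ∧ y ≤ q x} := ⟨hz, hc⟩
  rw [qLinv, if_pos ⟨z, hmem⟩] at h
  exact h.not_ge (le_csSup ⟨b, fun t ht => ht.1.2⟩ hmem)

theorem pRinv_antitone {a b : ℝ} (hab : a ≤ b) {p : ℝ → ℝ} (hp : AntitoneOn p (Icc a b)) :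
    Antitone (pRinv a b p) := by
  intro y₁ y₂ h
  by_contra! hc
  obtain ⟨z, h₁, h₂⟩ := exists_between hc
  have hz : z ∈ Icc a b :=
    ⟨(pRinv_mem hab p y₁).1.trans h₁.le, h₂.le.trans (pRinv_mem hab p y₂).2⟩
  linarith [le_of_pRinv_lt hp hz h₁, lt_of_lt_pRinv hz h₂]

theorem qLinv_antitone {a b : ℝ} (hab : a ≤ b) {q : ℝ → ℝ} (hq : AntitoneOn q (Icc a b)) :
    Antitone (qLinv a b q) := by
  intro y₁ y₂ h
  by_contra! hc
  obtain ⟨z, h₁, h₂⟩ := exists_between hc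
  have hz : z ∈ Icc a b :=
    ⟨(qLinv_mem hab q y₁).1.trans h₁.le, h₂.le.trans (qLinv_mem hab q y₂).2⟩
  linarith [lt_of_qLinv_lt hz h₁, le_of_lt_qLinv hq hz h₂]

theorem supportPoint_mem {a b : ℝ} (hab : a ≤ b) (p q : ℝ → ℝ) (x : ℝ) :
    supportPoint a b p q x ∈ Icc a b := by
  unfold supportPoint
  split_ifs with h₁ h₂
  · exact pRinv_mem hab p x
  · exact ⟨not_lt.1 h₁, h₂⟩
  · exact qLinv_mem hab q x

theorem deltaFn_eq (a b x₀ : ℝ) (p q : ℝ → ℝ) (x : ℝ) :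
    deltaFn a b x₀ p q x = thetaFn p q x₀ (supportPoint a b p q x) := by
  unfold deltaFn supportPoint
  split_ifs <;> rfl

theorem integrableOn_inv_gap {a b : ℝ} (hab : a < b) {p q : ℝ → ℝ}
    (hp : AntitoneOn p (Icc a b)) (hq : AntitoneOn q (Icc a b))
    (hpa : ∀ x ∈ Icc a b, p x ≤ a) (hqb : ∀ x ∈ Icc a b, b ≤ q x) :
    IntegrableOn (fun z => (q z - p z)⁻¹) (Icc a b) := by
  have hm : AEStronglyMeasurable (fun z => (q z - p z)⁻¹) (volume.restrict (Icc a b)) :=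
    (((aemeasurable_restrict_of_antitoneOn measurableSet_Icc hq).sub
      (aemeasurable_restrict_of_antitoneOn measurableSet_Icc hp)).inv).aestronglyMeasurable
  refine Integrable.of_bound hm (b - a)⁻¹ ?_
  filter_upwards [ae_restrict_mem measurableSet_Icc] with z hz
  have h : b - a ≤ q z - p z := by linarith [hpa z hz, hqb z hz]
  have h' : 0 < b - a := sub_pos.2 hab
  rw [norm_inv, Real.norm_eq_abs, abs_of_pos (h'.trans_le h)]
  exact inv_anti₀ h' h

theorem intervalIntegrable_two_div_gap {a b : ℝ} (hab : a < b) {p q : ℝ → ℝ}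
    (hp : AntitoneOn p (Icc a b)) (hq : AntitoneOn q (Icc a b))
    (hpa : ∀ x ∈ Icc a b, p x ≤ a) (hqb : ∀ x ∈ Icc a b, b ≤ q x) {u v : ℝ}
    (hu : u ∈ Icc a b) (hv : v ∈ Icc a b) :
    IntervalIntegrable (fun z => 2 / (q z - p z)) volume u v := by
  have h := (integrableOn_inv_gap hab hp hq hpa hqb).mono_set (uIcc_subset_Icc hu hv)
  simpa only [div_eq_mul_inv] using h.intervalIntegrable.const_mul 2

theorem intervalIntegrable_dualDensity {a b : ℝ} (hab : a < b) {p q : ℝ → ℝ}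
    (hp : AntitoneOn p (Icc a b)) (hq : AntitoneOn q (Icc a b))
    (hpa : ∀ x ∈ Icc a b, p x ≤ a) (hqb : ∀ x ∈ Icc a b, b ≤ q x) (y : ℝ) {u v : ℝ}
    (hu : u ∈ Icc a b) (hv : v ∈ Icc a b) :
    IntervalIntegrable (dualDensity p q y) volume u v := by
  have ha : a ∈ Icc a b := left_mem_Icc.2 hab.le
  have hb : b ∈ Icc a b := right_mem_Icc.2 hab.le
  have hm : AEStronglyMeasurable (fun z => 2 * y - q z - p z) (volume.restrict (Icc a b)) :=
    ((aemeasurable_const.sub (aemeasurable_restrict_of_antitoneOn measurableSet_Icc hq)).sub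
      (aemeasurable_restrict_of_antitoneOn measurableSet_Icc hp)).aestronglyMeasurable
  have h : IntegrableOn (dualDensity p q y) (Icc a b) := by
    refine Integrable.bdd_mul (c := 2 * |y| + (|q a| + |q b|) + (|p a| + |p b|))
      (integrableOn_inv_gap hab hp hq hpa hqb) hm ?_
    filter_upwards [ae_restrict_mem measurableSet_Icc] with z hz
    have h₁ := hq ha hz hz.1
    have h₂ := hq hz hb hz.2
    have h₃ := hp ha hz hz.1
    have h₄ := hp hz hb hz.2
    rw [Real.norm_eq_abs, abs_le]
    constructor <;>
      linarith [neg_abs_le y, le_abs_self y, neg_abs_le (q a), le_abs_self (q a),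
        neg_abs_le (q b), le_abs_self (q b), neg_abs_le (p a), le_abs_self (p a),
        neg_abs_le (p b), le_abs_self (p b)]
  exact (h.mono_set (uIcc_subset_Icc hu hv)).intervalIntegrable

theorem thetaFn_monotoneOn {a b x₀ : ℝ} (hab : a < b) (hx₀ : x₀ ∈ Icc a b) {p q : ℝ → ℝ}
    (hp : AntitoneOn p (Icc a b)) (hq : AntitoneOn q (Icc a b))
    (hpa : ∀ x ∈ Icc a b, p x ≤ a) (hqb : ∀ x ∈ Icc a b, b ≤ q x) :
    MonotoneOn (thetaFn p q x₀) (Icc a b) := by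
  intro u hu v hv huv
  have hi := fun {s t : ℝ} (hs : s ∈ Icc a b) (ht : t ∈ Icc a b) =>
    intervalIntegrable_two_div_gap hab hp hq hpa hqb hs ht
  have h := integral_add_adjacent_intervals (hi hx₀ hu) (hi hu hv)
  have h₀ : 0 ≤ ∫ z in u..v, 2 / (q z - p z) := by
    refine intervalIntegral.integral_nonneg huv fun z hz => ?_
    have hz' : z ∈ Icc a b := ⟨hu.1.trans hz.1, hz.2.trans hv.2⟩
    exact div_nonneg zero_le_two (by linarith [hpa z hz', hqb z hz'])
  unfold thetaFn
  linarith

theorem dualAffine_sub {a b x₀ : ℝ} (hab : a < b) (hx₀ : x₀ ∈ Icc a b) {p q : ℝ → ℝ}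
    (hp : AntitoneOn p (Icc a b)) (hq : AntitoneOn q (Icc a b))
    (hpa : ∀ x ∈ Icc a b, p x ≤ a) (hqb : ∀ x ∈ Icc a b, b ≤ q x) (x y : ℝ) {v : ℝ}
    (hv : v ∈ Icc a b) :
    dualAffine p q x₀ y v - dualAffine p q x₀ x v = thetaFn p q x₀ v * (y - x) := by
  unfold dualAffine thetaFn
  rw [← intervalIntegral.integral_sub
    (intervalIntegrable_dualDensity hab hp hq hpa hqb y hx₀ hv)
    (intervalIntegrable_dualDensity hab hp hq hpa hqb x hx₀ hv),
    ← intervalIntegral.integral_mul_const]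
  congr 1
  ext z
  simp only [dualDensity]
  ring

theorem mul_sub_le_dualAffine_sub {a b x₀ : ℝ} (hab : a < b) (hx₀ : x₀ ∈ Icc a b) {p q : ℝ → ℝ}
    (hp : AntitoneOn p (Icc a b)) (hq : AntitoneOn q (Icc a b))
    (hpa : ∀ x ∈ Icc a b, p x ≤ a) (hqb : ∀ x ∈ Icc a b, b ≤ q x) {y c u v : ℝ}
    (hu : u ∈ Icc a b) (hv : v ∈ Icc a b) (huv : u ≤ v)
    (h : ∀ z ∈ Ioo u v, c * (q z - p z) ≤ 2 * y - q z - p z) :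
    c * (v - u) ≤ dualAffine p q x₀ y v - dualAffine p q x₀ y u := by
  have hi := fun {s t : ℝ} (hs : s ∈ Icc a b) (ht : t ∈ Icc a b) =>
    intervalIntegrable_dualDensity hab hp hq hpa hqb y hs ht
  unfold dualAffine
  rw [integral_interval_sub_left (hi hx₀ hv) (hi hx₀ hu)]
  calc c * (v - u) = ∫ _ in u..v, c := by simp [mul_comm]
    _ ≤ _ := by
      refine integral_mono_on_of_le_Ioo huv intervalIntegrable_const (hi hu hv) fun z hz => ?_
      have hz' : z ∈ Icc a b := ⟨hu.1.trans hz.1.le, hz.2.le.trans hv.2⟩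
      exact (le_div_iff₀ (by linarith [hpa z hz', hqb z hz'])).2 (h z hz)

theorem dualAffine_sub_le_mul_sub {a b x₀ : ℝ} (hab : a < b) (hx₀ : x₀ ∈ Icc a b) {p q : ℝ → ℝ}
    (hp : AntitoneOn p (Icc a b)) (hq : AntitoneOn q (Icc a b))
    (hpa : ∀ x ∈ Icc a b, p x ≤ a) (hqb : ∀ x ∈ Icc a b, b ≤ q x) {y c u v : ℝ}
    (hu : u ∈ Icc a b) (hv : v ∈ Icc a b) (huv : u ≤ v)
    (h : ∀ z ∈ Ioo u v, 2 * y - q z - p z ≤ c * (q z - p z)) :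
    dualAffine p q x₀ y v - dualAffine p q x₀ y u ≤ c * (v - u) := by
  have hi := fun {s t : ℝ} (hs : s ∈ Icc a b) (ht : t ∈ Icc a b) =>
    intervalIntegrable_dualDensity hab hp hq hpa hqb y hs ht
  unfold dualAffine
  rw [integral_interval_sub_left (hi hx₀ hv) (hi hx₀ hu)]
  calc
    _ ≤ ∫ _ in u..v, c := by
      refine integral_mono_on_of_le_Ioo huv (hi hu hv) intervalIntegrable_const fun z hz => ?_
      have hz' : z ∈ Icc a b := ⟨hu.1.trans hz.1.le, hz.2.le.trans hv.2⟩
      exact (div_le_iff₀ (by linarith [hpa z hz', hqb z hz'])).2 (h z hz)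
    _ = c * (v - u) := by simp [mul_comm]

theorem psiFn_eq {a b x₀ : ℝ} (hab : a < b) (hx₀ : x₀ ∈ Icc a b) {p q : ℝ → ℝ}
    (hp : AntitoneOn p (Icc a b)) (hq : AntitoneOn q (Icc a b))
    (hpa : ∀ x ∈ Icc a b, p x ≤ a) (hqb : ∀ x ∈ Icc a b, b ≤ q x) (x : ℝ) :
    psiFn a b x₀ p q x
      = |x - supportPoint a b p q x| + dualAffine p q x₀ x (supportPoint a b p q x) := by
  have hα : ∀ v, alphaFn p q x₀ v = dualAffine p q x₀ v v := fun _ => rfl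
  unfold psiFn supportPoint
  split_ifs with h₁ h₂
  · have hu := pRinv_mem hab.le p x
    rw [hα, abs_of_nonpos (by linarith [hu.1])]
    linarith [dualAffine_sub hab hx₀ hp hq hpa hqb x (pRinv a b p x) hu]
  · simp [hα]
  · have hu := qLinv_mem hab.le q x
    rw [hα, abs_of_nonneg (by linarith [hu.2])]
    linarith [dualAffine_sub hab hx₀ hp hq hpa hqb x (qLinv a b q x) hu]

theorem psiFn_le {a b x₀ : ℝ} (hab : a < b) (hx₀ : x₀ ∈ Icc a b) {p q : ℝ → ℝ}
    (hp : AntitoneOn p (Icc a b)) (hq : AntitoneOn q (Icc a b))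
    (hpa : ∀ x ∈ Icc a b, p x ≤ a) (hqb : ∀ x ∈ Icc a b, b ≤ q x) (y : ℝ) {w : ℝ}
    (hw : w ∈ Icc a b) :
    psiFn a b x₀ p q y ≤ |y - w| + dualAffine p q x₀ y w := by
  have hlow := fun {c u v : ℝ} => mul_sub_le_dualAffine_sub (y := y) (c := c) (u := u) (v := v)
    hab hx₀ hp hq hpa hqb
  have hupp := fun {c u v : ℝ} => dualAffine_sub_le_mul_sub (y := y) (c := c) (u := u) (v := v)
    hab hx₀ hp hq hpa hqb
  have hu := supportPoint_mem hab.le p q y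
  have hsub : ∀ {s t z : ℝ}, s ∈ Icc a b → t ∈ Icc a b → z ∈ Ioo s t → z ∈ Icc a b :=
    fun hs ht hz => ⟨hs.1.trans hz.1.le, hz.2.le.trans ht.2⟩
  rw [psiFn_eq hab hx₀ hp hq hpa hqb]
  rcases lt_or_ge y a with hya | hya
  · have hue : supportPoint a b p q y = pRinv a b p y := if_pos hya
    rw [hue] at hu ⊢
    rw [abs_of_nonpos (by linarith [hu.1]), abs_of_nonpos (by linarith [hw.1])]
    rcases le_total (pRinv a b p y) w with h | h
    · have := hlow (c := -1) hu hw h fun z hz => by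
        linarith [le_of_pRinv_lt hp (hsub hu hw hz) hz.1]
      linarith
    · have := hupp (c := -1) hw hu h fun z hz => by
        linarith [lt_of_lt_pRinv (hsub hw hu hz) hz.2]
      linarith
  rcases le_or_gt y b with hyb | hyb
  · have hue : supportPoint a b p q y = y := by
      rw [supportPoint, if_neg hya.not_gt, if_pos hyb]
    rw [hue] at hu ⊢
    rw [sub_self, abs_zero, zero_add]
    rcases le_total y w with h | h
    · have := hlow (c := -1) hu hw h fun z hz => by
        linarith [hpa z (hsub hu hw hz)]
      rw [abs_of_nonpos (by linarith)]
      linarith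
    · have := hupp (c := 1) hw hu h fun z hz => by
        linarith [hqb z (hsub hw hu hz)]
      rw [abs_of_nonneg (by linarith)]
      linarith
  · have hue : supportPoint a b p q y = qLinv a b q y := by
      rw [supportPoint, if_neg hya.not_gt, if_neg hyb.not_ge]
    rw [hue] at hu ⊢
    rw [abs_of_nonneg (by linarith [hu.2]), abs_of_nonneg (by linarith [hw.2])]
    rcases le_total (qLinv a b q y) w with h | h
    · have := hlow (c := 1) hu hw h fun z hz => by
        linarith [lt_of_qLinv_lt (hsub hu hw hz) hz.1]
      linarith
    · have := hupp (c := 1) hw hu h fun z hz => by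
        linarith [le_of_lt_qLinv hq (hsub hw hu hz) hz.2]
      linarith

theorem LagFn_nonneg {a b x₀ : ℝ} (hab : a < b) (hx₀ : x₀ ∈ Icc a b) {p q : ℝ → ℝ}
    (hp : AntitoneOn p (Icc a b)) (hq : AntitoneOn q (Icc a b))
    (hpa : ∀ x ∈ Icc a b, p x ≤ a) (hqb : ∀ x ∈ Icc a b, b ≤ q x) (x y : ℝ) :
    0 ≤ LagFn a b x₀ p q x y := by
  have hu := supportPoint_mem hab.le p q x
  unfold LagFn
  rw [psiFn_eq hab hx₀ hp hq hpa hqb x, deltaFn_eq]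
  linarith [psiFn_le hab hx₀ hp hq hpa hqb y hu, dualAffine_sub hab hx₀ hp hq hpa hqb x y hu,
    abs_sub_le y x (supportPoint a b p q x)]

theorem measurable_deltaFn {a b x₀ : ℝ} (hab : a < b) (hx₀ : x₀ ∈ Icc a b) {p q : ℝ → ℝ}
    (hp : AntitoneOn p (Icc a b)) (hq : AntitoneOn q (Icc a b))
    (hpa : ∀ x ∈ Icc a b, p x ≤ a) (hqb : ∀ x ∈ Icc a b, b ≤ q x) :
    Measurable (deltaFn a b x₀ p q) := by
  have hθ := thetaFn_monotoneOn hab hx₀ hp hq hpa hqb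
  have h₁ : Measurable fun x => thetaFn p q x₀ (pRinv a b p x) :=
    Antitone.measurable fun s t h =>
      hθ (pRinv_mem hab.le p t) (pRinv_mem hab.le p s) (pRinv_antitone hab.le hp h)
  have h₂ : Measurable fun x => thetaFn p q x₀ (projIcc a b hab.le x) :=
    Monotone.measurable fun s t h => hθ (projIcc a b hab.le s).2 (projIcc a b hab.le t).2
      (monotone_projIcc hab.le h)
  have h₃ : Measurable fun x => thetaFn p q x₀ (qLinv a b q x) :=
    Antitone.measurable fun s t h =>
      hθ (qLinv_mem hab.le q t) (qLinv_mem hab.le q s) (qLinv_antitone hab.le hq h)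
  have h : Measurable fun x => if x < a then thetaFn p q x₀ (pRinv a b p x)
      else if x ≤ b then thetaFn p q x₀ (projIcc a b hab.le x)
      else thetaFn p q x₀ (qLinv a b q x) :=
    Measurable.ite measurableSet_Iio h₁ (Measurable.ite measurableSet_Iic h₂ h₃)
  convert h using 1
  ext x
  unfold deltaFn
  split_ifs with hxa hxb
  · rfl
  · rw [projIcc_of_mem hab.le ⟨not_lt.1 hxa, hxb⟩]
  · rfl

theorem exists_abs_deltaFn_le {a b x₀ : ℝ} (hab : a < b) (hx₀ : x₀ ∈ Icc a b) {p q : ℝ → ℝ}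
    (hp : AntitoneOn p (Icc a b)) (hq : AntitoneOn q (Icc a b))
    (hpa : ∀ x ∈ Icc a b, p x ≤ a) (hqb : ∀ x ∈ Icc a b, b ≤ q x) :
    ∃ C : ℝ, ∀ x, |deltaFn a b x₀ p q x| ≤ C := by
  have hθ := thetaFn_monotoneOn hab hx₀ hp hq hpa hqb
  refine ⟨max |thetaFn p q x₀ a| |thetaFn p q x₀ b|, fun x => ?_⟩
  have hu := supportPoint_mem hab.le p q x
  rw [deltaFn_eq]
  exact abs_le_max_abs_abs (hθ (left_mem_Icc.2 hab.le) hu hu.1)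
    (hθ hu (right_mem_Icc.2 hab.le) hu.2)

theorem stmt17 (a b x₀ : ℝ) (hab : a < b) (hx₀ : x₀ ∈ Icc a b)
    (p q : ℝ → ℝ)
    (hp : AntitoneOn p (Icc a b)) (hq : AntitoneOn q (Icc a b))
    (hpa : ∀ x ∈ Icc a b, p x ≤ a) (hqb : ∀ x ∈ Icc a b, b ≤ q x)
    (μ ν : Measure ℝ) [IsProbabilityMeasure μ] [IsProbabilityMeasure ν]
    (hμ : Integrable id μ) (hν : Integrable id ν)
    (hψμ : Integrable (psiFn a b x₀ p q) μ) (hψν : Integrable (psiFn a b x₀ p q) ν) :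
    ∀ ρ : Measure (ℝ × ℝ), IsMartingaleCoupling μ ν ρ →
      ∫ y, psiFn a b x₀ p q y ∂ν - ∫ x, psiFn a b x₀ p q x ∂μ
        ≤ ∫ w : ℝ × ℝ, |w.2 - w.1| ∂ρ := by
  rintro ρ ⟨_, rfl, rfl, hmart⟩
  have hfst : Integrable (fun w : ℝ × ℝ => w.1) ρ := hμ.comp_measurable measurable_fst
  have hsnd : Integrable (fun w : ℝ × ℝ => w.2) ρ := hν.comp_measurable measurable_snd
  have hψfst : Integrable (fun w : ℝ × ℝ => psiFn a b x₀ p q w.1) ρ :=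
    hψμ.comp_measurable measurable_fst
  have hψsnd : Integrable (fun w : ℝ × ℝ => psiFn a b x₀ p q w.2) ρ :=
    hψν.comp_measurable measurable_snd
  have hδ := measurable_deltaFn hab hx₀ hp hq hpa hqb
  obtain ⟨C, hC⟩ := exists_abs_deltaFn_le hab hx₀ hp hq hpa hqb
  have hinc : Integrable (fun w : ℝ × ℝ => w.2 - w.1) ρ := hsnd.sub hfst
  have hδinc : Integrable (fun w : ℝ × ℝ => deltaFn a b x₀ p q w.1 * (w.2 - w.1)) ρ :=
    hinc.bdd_mul (c := C) (hδ.comp measurable_fst).aestronglyMeasurable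
      (ae_of_all _ fun w => hC w.1)
  have hψinc : Integrable (fun w : ℝ × ℝ => psiFn a b x₀ p q w.2 - psiFn a b x₀ p q w.1) ρ :=
    hψsnd.sub hψfst
  have hzero := hmart _ hδ ⟨C, hC⟩
  rw [integral_map measurable_snd.aemeasurable hψν.aestronglyMeasurable,
    integral_map measurable_fst.aemeasurable hψμ.aestronglyMeasurable]
  calc ∫ w : ℝ × ℝ, psiFn a b x₀ p q w.2 ∂ρ - ∫ w : ℝ × ℝ, psiFn a b x₀ p q w.1 ∂ρ
      = ∫ w : ℝ × ℝ, (psiFn a b x₀ p q w.2 - psiFn a b x₀ p q w.1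
          - deltaFn a b x₀ p q w.1 * (w.2 - w.1)) ∂ρ := by
        rw [integral_sub hψinc hδinc, integral_sub hψsnd hψfst, hzero, sub_zero]
    _ ≤ ∫ w : ℝ × ℝ, |w.2 - w.1| ∂ρ := by
        refine integral_mono (hψinc.sub hδinc) hinc.abs fun w => ?_
        have h := LagFn_nonneg hab hx₀ hp hq hpa hqb w.1 w.2
        unfold LagFn at h
        show _ - _ - _ ≤ _
        linarith
end
end

section
/- Define p(x) = (−x − √(12 − 3x²))/2 and q(x) = (−x + √(12 − 3x²))/2 for x ∈ [−1,1]. Then p and q are differentiable on (−1,1) with p′(x) = (x − q(x))/(q(x) − p(x)) and q′(x) = (p(x) − x)/(q(x) − p(x)) for all x ∈ (−1,1), and the boundary conditions p(−1) = −1, q(−1) = 2, p(1) = −2, q(1) = 1 hold. (These are the coupled differential equations for the minimising martingale coupling of μ = uniform on [−1,1] and ν = uniform on [−2,2].) -/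
open Set

noncomputable section

/-- p(x) = (−x − √(12 − 3x²))/2. -/
def pEx (x : ℝ) : ℝ := (-x - Real.sqrt (12 - 3 * x ^ 2)) / 2

/-- q(x) = (−x + √(12 − 3x²))/2. -/
def qEx (x : ℝ) : ℝ := (-x + Real.sqrt (12 - 3 * x ^ 2)) / 2

theorem hasDerivAt_sqrt_twelve_sub {x : ℝ} (h : 0 < 12 - 3 * x ^ 2) :
    HasDerivAt (fun y : ℝ => Real.sqrt (12 - 3 * y ^ 2))
      (-(3 * x) / Real.sqrt (12 - 3 * x ^ 2)) x := by
  have hpoly : HasDerivAt (fun y : ℝ => 12 - 3 * y ^ 2) (-(6 * x)) x := by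
    refine (((hasDerivAt_pow 2 x).const_mul 3).const_sub 12).congr_deriv ?_
    push_cast
    ring
  have hs := Real.sqrt_pos.2 h
  refine (hpoly.sqrt h.ne').congr_deriv ?_
  field_simp
  ring

theorem qEx_sub_pEx (x : ℝ) : qEx x - pEx x = Real.sqrt (12 - 3 * x ^ 2) := by
  unfold qEx pEx
  ring

theorem stmt18 :
    (∀ x ∈ Ioo (-1 : ℝ) 1,
      HasDerivAt pEx ((x - qEx x) / (qEx x - pEx x)) x ∧
      HasDerivAt qEx ((pEx x - x) / (qEx x - pEx x)) x) ∧
    pEx (-1) = -1 ∧ qEx (-1) = 2 ∧ pEx 1 = -2 ∧ qEx 1 = 1 := by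
  have sqrt_nine : Real.sqrt 9 = 3 := by
    rw [show (9 : ℝ) = 3 ^ 2 by norm_num]
    exact Real.sqrt_sq (by norm_num)
  refine ⟨fun x hx => ?_, ?_, ?_, ?_, ?_⟩
  · have h : 0 < 12 - 3 * x ^ 2 := by nlinarith [hx.1, hx.2]
    have hs := Real.sqrt_pos.2 h
    have hd := hasDerivAt_sqrt_twelve_sub h
    rw [qEx_sub_pEx]
    constructor
    · refine (((hasDerivAt_id x).neg.sub hd).div_const 2).congr_deriv ?_
      unfold qEx
      field_simp
      ring
    · refine (((hasDerivAt_id x).neg.add hd).div_const 2).congr_deriv ?_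
      unfold pEx
      field_simp
      ring
  all_goals norm_num [pEx, qEx, sqrt_nine]
end
end
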